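/- arXiv:2003.01291 — 8 statements merged into one kernel-verified Lean document; each statement's English description precedes it below -/
import Mathlib

section
/- Let d, 𝐝, 𝐋 ∈ ℕ, L, a ∈ ℝ, b ∈ (a,∞), u ∈ [−∞,∞), v ∈ (u,∞], 𝐥 = (𝐥₀,…,𝐥_𝐋) ∈ ℕ^{𝐋+1} with 𝐥₀ = d, 𝐥_𝐋 = 1, and 𝐝 ≥ Σ_{i=1}^{𝐋} 𝐥ᵢ(𝐥_{i−1}+1), and let f : [a,b]^d → ([u,v] ∩ ℝ) satisfy |f(x) − f(y)| ≤ L‖x−y‖₁ for all x, y ∈ [a,b]^d. Then there exists ϑ ∈ ℝ^𝐝 such that ‖ϑ‖_∞ ≤ sup_{x ∈ [a,b]^d} |f(x)| and sup_{x ∈ [a,b]^d} |N^{ϑ,𝐥}_{u,v}(x) − f(x)| ≤ d·L·(b−a)/2. -/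
/-- Affine map with weights/biases read from the parameter vector `θ` starting at offset `s`. -/
noncomputable def affine (θ : ℕ → ℝ) (s m n : ℕ) (x : ℕ → ℝ) : ℕ → ℝ :=
  fun i => (∑ j ∈ Finset.range n, θ (s + i * n + j) * x j) + θ (s + m * n + i)

/-- Offset of the parameters of the `(k+1)`-st affine transformation. -/
def off (l : ℕ → ℕ) (k : ℕ) : ℕ := ∑ i ∈ Finset.range k, l (i + 1) * (l i + 1)

/-- The first `k` hidden layers (affine map followed by componentwise ReLU). -/
noncomputable def hiddenLayers (θ : ℕ → ℝ) (l : ℕ → ℕ) : ℕ → (ℕ → ℝ) → (ℕ → ℝ)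
  | 0, x => x
  | k + 1, x => fun i => max (affine θ (off l k) (l (k + 1)) (l k) (hiddenLayers θ l k x) i) 0

/-- Realization of the rectified clipped DNN with parameter `θ`, layer dimensions `l`,
`L` affine transformations, output dimension `l L = 1`, and clipping bounds
`u ∈ [-∞,∞)`, `v ∈ (u,∞]` (extended reals). -/
noncomputable def dnnE (θ : ℕ → ℝ) (l : ℕ → ℕ) (L : ℕ) (u v : EReal) (x : ℕ → ℝ) : ℝ :=
  (max u (min ((affine θ (off l (L - 1)) (l L) (l (L - 1))
    (hiddenLayers θ l (L - 1) x) 0 : ℝ) : EReal) v)).toReal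

/-- Extension of a vector `θ ∈ ℝ^m` to an `ℕ`-indexed family (by zero). -/
def pad {m : ℕ} (θ : Fin m → ℝ) : ℕ → ℝ := fun i => if h : i < m then θ ⟨i, h⟩ else 0

/-- A network all of whose parameters vanish, except possibly the bias `c` of the last layer, is
constant equal to `c` as long as `c` lies within the clipping bounds. -/
theorem dnnE_eq_of_only_last_bias (θ : ℕ → ℝ) (l : ℕ → ℕ) (k : ℕ) (u v : EReal) (c : ℝ)
    (hl : l (k + 1) = 1) (hθ : ∀ j < l k, θ (off l k + j) = 0)
    (hc : θ (off l k + l k) = c) (hu : u ≤ (c : EReal)) (hv : (c : EReal) ≤ v) (x : ℕ → ℝ) :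
    dnnE θ l (k + 1) u v x = c := by
  have hA : ∀ y : ℕ → ℝ, affine θ (off l k) 1 (l k) y 0 = c := fun y => by
    have hsum : ∑ j ∈ Finset.range (l k), θ (off l k + j) * y j = 0 :=
      Finset.sum_eq_zero fun j hj => by rw [hθ j (Finset.mem_range.mp hj), zero_mul]
    simp [affine, hsum, hc]
  simp only [dnnE, Nat.add_sub_cancel, hl, hA]
  rw [min_eq_left hv, max_eq_right hu, EReal.toReal_coe]

theorem stmt1 (d dd LL : ℕ) (hd : 0 < d) (hdd : 0 < dd) (hLL : 0 < LL)
    (L a b : ℝ) (hab : a < b) (u v : EReal) (hu : u < ⊤) (huv : u < v)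
    (l : ℕ → ℕ) (hl : ∀ i, i ≤ LL → 0 < l i) (hl0 : l 0 = d) (hlL : l LL = 1)
    (hdim : ∑ i ∈ Finset.range LL, l (i + 1) * (l i + 1) ≤ dd)
    (f : (Fin d → ℝ) → ℝ)
    (hf : ∀ x : Fin d → ℝ, (∀ i, x i ∈ Set.Icc a b) →
      u ≤ (f x : EReal) ∧ (f x : EReal) ≤ v)
    (hfLip : ∀ x y : Fin d → ℝ, (∀ i, x i ∈ Set.Icc a b) → (∀ i, y i ∈ Set.Icc a b) →
      |f x - f y| ≤ L * ∑ i, |x i - y i|) :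
    ∃ ϑ : Fin dd → ℝ,
      (∀ i, |ϑ i| ≤ ⨆ x : {z : Fin d → ℝ // ∀ i, z i ∈ Set.Icc a b}, |f x.1|) ∧
      ∀ x : Fin d → ℝ, (∀ i, x i ∈ Set.Icc a b) →
        |dnnE (pad ϑ) l LL u v (pad x) - f x| ≤ d * L * (b - a) / 2 := by
  obtain ⟨k, rfl⟩ : ∃ k, LL = k + 1 := ⟨LL - 1, by omega⟩
  let m : Fin d → ℝ := fun _ => (a + b) / 2
  have hm : ∀ i, m i ∈ Set.Icc a b := fun i => by
    constructor <;> simp only [m] <;> linarith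
  have hdR : (0 : ℝ) < d := by exact_mod_cast hd
  have hL : 0 ≤ L := by
    have h := (abs_nonneg _).trans (hfLip (fun _ => b) (fun _ => a)
      (fun _ => ⟨hab.le, le_rfl⟩) (fun _ => ⟨le_rfl, hab.le⟩))
    simp only [Finset.sum_const, Finset.card_univ, Fintype.card_fin, nsmul_eq_mul] at h
    exact nonneg_of_mul_nonneg_left h (mul_pos hdR (abs_pos.mpr (by linarith)))
  have hdist : ∀ x : Fin d → ℝ, (∀ i, x i ∈ Set.Icc a b) →
      |f m - f x| ≤ d * L * (b - a) / 2 := by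
    intro x hx
    have hsum : ∑ i, |m i - x i| ≤ d * ((b - a) / 2) := by
      calc ∑ i, |m i - x i| ≤ ∑ _i : Fin d, (b - a) / 2 := by
            refine Finset.sum_le_sum fun i _ => abs_le.mpr ?_
            have := (hx i).1
            have := (hx i).2
            constructor <;> simp only [m] <;> linarith
        _ = d * ((b - a) / 2) := by simp
    calc |f m - f x| ≤ L * ∑ i, |m i - x i| := hfLip m x hm hx
      _ ≤ L * (d * ((b - a) / 2)) := mul_le_mul_of_nonneg_left hsum hL
      _ = d * L * (b - a) / 2 := by ring
  have hbdd : BddAbove (Set.range fun x : {z : Fin d → ℝ // ∀ i, z i ∈ Set.Icc a b} =>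
      |f x.1|) := by
    refine ⟨|f m| + d * L * (b - a) / 2, ?_⟩
    rintro _ ⟨x, rfl⟩
    have h := hdist x.1 x.2
    rw [abs_sub_comm] at h
    have h' := abs_sub_abs_le_abs_sub (f x.1) (f m)
    simp only
    linarith
  have hsup : |f m| ≤ ⨆ x : {z : Fin d → ℝ // ∀ i, z i ∈ Set.Icc a b}, |f x.1| :=
    le_ciSup hbdd ⟨m, hm⟩
  have hlast : off l k + l k < dd := by
    rw [Finset.sum_range_succ, hlL] at hdim
    simp only [off]
    omega
  refine ⟨fun i => if (i : ℕ) = off l k + l k then f m else 0, fun i => ?_, fun x hx => ?_⟩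
  · dsimp only
    split_ifs
    · exact hsup
    · simpa using (abs_nonneg _).trans hsup
  · rw [dnnE_eq_of_only_last_bias _ l k u v (f m) hlL ?_ ?_ (hf m hm).1 (hf m hm).2]
    · exact hdist x hx
    · intro j hj
      simp [pad, hj.ne]
    · simp [pad, hlast]
end

section
/- Let d, 𝐝, 𝐋 ∈ ℕ, A ∈ (0,∞), L, a ∈ ℝ, b ∈ (a,∞), u ∈ [−∞,∞), v ∈ (u,∞], 𝐥 = (𝐥₀,…,𝐥_𝐋) ∈ ℕ^{𝐋+1} satisfy 𝐋 ≥ A·1_{(6^d,∞)}(A)/(2d) + 1, 𝐥₀ = d, 𝐥₁ ≥ A·1_{(6^d,∞)}(A), 𝐥_𝐋 = 1, 𝐝 ≥ Σ_{i=1}^{𝐋} 𝐥ᵢ(𝐥_{i−1}+1), and 𝐥ᵢ ≥ 1_{(6^d,∞)}(A)·max{A/d − 2i + 3, 2} for all integers i with 2 ≤ i < 𝐋, and let f : [a,b]^d → ([u,v] ∩ ℝ) satisfy |f(x) − f(y)| ≤ L‖x−y‖₁ for all x,y ∈ [a,b]^d. Then there exists ϑ ∈ ℝ^𝐝 such that ‖ϑ‖_∞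 ≤ max{1, L, |a|, |b|, 2·sup_{x ∈ [a,b]^d}|f(x)|} and sup_{x ∈ [a,b]^d} |N^{ϑ,𝐥}_{u,v}(x) − f(x)| ≤ 3·d·L·(b−a)/A^{1/d}. -/
/-- Any prescribed bounded weights and biases are realized by a bounded parameter vector. -/
theorem exists_parameter_vector (l : ℕ → ℕ) (W : ℕ → ℕ → ℕ → ℝ) (B : ℕ → ℕ → ℝ) {C : ℝ}
    (hC : 0 ≤ C) (hW : ∀ k i j, |W k i j| ≤ C) (hB : ∀ k i, |B k i| ≤ C) (K : ℕ) :
    ∃ θ : ℕ → ℝ, (∀ t, |θ t| ≤ C) ∧ ∀ k < K,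
      (∀ i < l (k + 1), ∀ j < l k, θ (off l k + i * l k + j) = W k i j) ∧
      ∀ i < l (k + 1), θ (off l k + l (k + 1) * l k + i) = B k i := by
  induction K with
  | zero => exact ⟨fun _ => 0, by simpa using hC, by simp⟩
  | succ K ih =>
    obtain ⟨θ, hθ, h⟩ := ih
    refine ⟨fun t => if t < off l K then θ t else
      if t - off l K < l (K + 1) * l K then W K ((t - off l K) / l K) ((t - off l K) % l K)
      else B K (t - off l K - l (K + 1) * l K), ?_, ?_⟩
    · intro t
      dsimp only
      split_ifs
      exacts [hθ t, hW _ _ _, hB _ _]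
    · intro k hk
      have entry_lt : ∀ i < l (k + 1), ∀ j < l k, i * l k + j < l (k + 1) * l k := by
        intro i hi j hj
        nlinarith [Nat.mul_le_mul_right (l k) (Nat.succ_le_of_lt hi)]
      rcases Nat.lt_succ_iff_lt_or_eq.mp hk with hlt | rfl
      · have hoff : off l k + l (k + 1) * (l k + 1) ≤ off l K := by
          have h1 : off l (k + 1) = off l k + l (k + 1) * (l k + 1) :=
            Finset.sum_range_succ _ _
          rw [← h1]
          exact Finset.sum_le_sum_of_subset (Finset.range_mono hlt)
        rw [mul_add, mul_one] at hoff
        refine ⟨fun i hi j hj => ?_, fun i hi => ?_⟩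
        · have := entry_lt i hi j hj
          beta_reduce
          rw [if_pos (by omega)]
          exact (h k hlt).1 i hi j hj
        · beta_reduce
          rw [if_pos (by omega)]
          exact (h k hlt).2 i hi
      · refine ⟨fun i hi j hj => ?_, fun i hi => ?_⟩
        · have := entry_lt i hi j hj
          have e : off l k + i * l k + j - off l k = i * l k + j := by omega
          beta_reduce
          rw [if_neg (by omega), e, if_pos this, Nat.mul_comm i,
            Nat.mul_add_div (by omega), Nat.mul_add_mod, Nat.div_eq_of_lt hj, Nat.mod_eq_of_lt hj,
            add_zero]
        · beta_reduce
          rw [if_neg (by omega), if_neg (by omega)]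
          congr 1
          omega

theorem exists_affine_eq (l : ℕ → ℕ) (W : ℕ → ℕ → ℕ → ℝ) (B : ℕ → ℕ → ℝ) {C : ℝ}
    (hC : 0 ≤ C) (hW : ∀ k i j, |W k i j| ≤ C) (hB : ∀ k i, |B k i| ≤ C) {K D : ℕ}
    (hD : off l K ≤ D) :
    ∃ ϑ : Fin D → ℝ, (∀ t, |ϑ t| ≤ C) ∧ ∀ k < K, ∀ i < l (k + 1), ∀ x,
      affine (pad ϑ) (off l k) (l (k + 1)) (l k) x i
        = ∑ j ∈ Finset.range (l k), W k i j * x j + B k i := by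
  obtain ⟨θ, hθ, h⟩ := exists_parameter_vector l W B hC hW hB K
  refine ⟨fun t => θ t, fun t => hθ t, fun k hk i hi x => ?_⟩
  have hpad : ∀ t < D, pad (fun t : Fin D => θ t) t = θ t := fun t ht => by simp [pad, ht]
  have hoff : off l k + l (k + 1) * (l k + 1) ≤ D := by
    have h1 : off l (k + 1) = off l k + l (k + 1) * (l k + 1) := Finset.sum_range_succ _ _
    rw [← h1]
    exact (Finset.sum_le_sum_of_subset (Finset.range_mono hk)).trans hD
  rw [mul_add, mul_one] at hoff
  unfold affine
  rw [hpad _ (by omega), (h k hk).2 i hi]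
  congr 1
  refine Finset.sum_congr rfl fun j hj => ?_
  have hj := Finset.mem_range.mp hj
  have : i * l k + j < l (k + 1) * l k := by
    nlinarith [Nat.mul_le_mul_right (l k) (Nat.succ_le_of_lt hi)]
  rw [hpad _ (by omega), (h k hk).1 i hi j hj]

/-- Clipping to an interval containing `c` does not increase the distance to `c`. -/
theorem abs_toReal_clip_sub_le {u v : EReal} {c : ℝ} (hu : u ≤ (c : EReal))
    (hv : (c : EReal) ≤ v) (y : ℝ) :
    |(max u (min (y : EReal) v)).toReal - c| ≤ |y - c| := by
  set z := max u (min (y : EReal) v) with hz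
  have coe_of_between : ∀ p q : ℝ, (p : EReal) ≤ z → z ≤ (q : EReal) →
      p ≤ z.toReal ∧ z.toReal ≤ q := by
    intro p q hp hq
    have h1 : z ≠ ⊤ := ne_top_of_le_ne_top (EReal.coe_ne_top q) hq
    have h2 : z ≠ ⊥ := ne_bot_of_le_ne_bot (EReal.coe_ne_bot p) hp
    rw [← EReal.coe_toReal h1 h2] at hp hq
    exact ⟨EReal.coe_le_coe_iff.mp hp, EReal.coe_le_coe_iff.mp hq⟩
  rcases le_total c y with h | h
  · have h' : (c : EReal) ≤ y := EReal.coe_le_coe_iff.mpr h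
    have := coe_of_between c y (le_max_of_le_right (le_min h' hv))
      (max_le (hu.trans h') (min_le_left _ _))
    rw [abs_of_nonneg (by linarith), abs_of_nonneg (by linarith)]
    linarith
  · have h' : (y : EReal) ≤ c := EReal.coe_le_coe_iff.mpr h
    have := coe_of_between y c (le_max_of_le_right (le_min le_rfl (h'.trans hv)))
      (max_le hu ((min_le_left _ _).trans h'))
    rw [abs_of_nonpos (by linarith), abs_of_nonpos (by linarith)]
    linarith

/-- `runningMax p j` is the maximum of `0, p 0, …, p (j - 1)`. -/
noncomputable def runningMax (p : ℕ → ℝ) : ℕ → ℝ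
  | 0 => 0
  | j + 1 => max (runningMax p j - p j) 0 + p j

theorem runningMax_succ (p : ℕ → ℝ) (j : ℕ) :
    runningMax p (j + 1) = max (runningMax p j) (p j) := by
  simp [runningMax, max_add]

theorem le_runningMax (p : ℕ → ℝ) {k j : ℕ} (h : k < j) : p k ≤ runningMax p j := by
  induction j with
  | zero => omega
  | succ j ih =>
    rw [runningMax_succ]
    rcases Nat.lt_succ_iff_lt_or_eq.mp h with h | rfl
    · exact le_max_of_le_left (ih h)
    · exact le_max_right _ _

theorem runningMax_le {p : ℕ → ℝ} {c : ℝ} (hc : 0 ≤ c) (hp : ∀ k, p k ≤ c) (j : ℕ) :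
    runningMax p j ≤ c := by
  induction j with
  | zero => exact hc
  | succ j ih =>
    rw [runningMax_succ]
    exact max_le ih (hp j)

/-- The midpoints of the cells of a uniform grid cover a cube. -/
theorem exists_grid (d n : ℕ) (hn : 0 < n) {a b : ℝ} (hab : a < b) :
    ∃ y : ℕ → ℕ → ℝ, (∀ k i, y k i ∈ Set.Icc a b) ∧
      ∀ x : Fin d → ℝ, (∀ i, x i ∈ Set.Icc a b) →
        ∃ k < n ^ d, ∀ i : Fin d, |x i - y k i| ≤ (b - a) / (2 * n) := by
  have hn' : (0 : ℝ) < n := by exact_mod_cast hn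
  have hba : 0 < b - a := sub_pos.mpr hab
  have hcell : ∀ t ∈ Set.Icc a b, ∃ m : Fin n,
      |t - (a + (b - a) * (2 * (m : ℕ) + 1) / (2 * n))| ≤ (b - a) / (2 * n) := by
    intro t ht
    set s := (t - a) / (b - a) * n with hs
    have hts : t = a + (b - a) * (2 * s) / (2 * n) := by
      rw [hs]; field_simp; ring
    have hs0 : 0 ≤ s := by
      have := ht.1
      exact mul_nonneg (div_nonneg (by linarith) hba.le) hn'.le
    have hsn : s ≤ n := by
      have : (t - a) / (b - a) ≤ 1 := (div_le_one hba).mpr (by linarith [ht.2])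
      nlinarith
    obtain ⟨m, hm1, hm2⟩ : ∃ m : Fin n, ((m : ℕ) : ℝ) ≤ s ∧ s ≤ (m : ℕ) + 1 := by
      by_cases h : ⌊s⌋₊ < n
      · exact ⟨⟨_, h⟩, Nat.floor_le hs0, (Nat.lt_floor_add_one s).le⟩
      · have h1 : (n : ℝ) ≤ s := (Nat.le_floor_iff hs0).mp (not_lt.mp h)
        have h2 : ((n - 1 : ℕ) : ℝ) + 1 = n := by
          rw [Nat.cast_sub hn]; simp
        exact ⟨⟨n - 1, by omega⟩, by simp only; linarith, by simp only; linarith⟩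
    refine ⟨m, ?_⟩
    have e : t - (a + (b - a) * (2 * (m : ℕ) + 1) / (2 * n))
        = (b - a) / (2 * n) * (2 * s - (2 * (m : ℕ) + 1)) := by
      conv_lhs => rw [hts]
      ring
    rw [e, abs_mul, abs_of_pos (by positivity)]
    refine mul_le_of_le_one_right (by positivity) ?_
    rw [abs_le]
    constructor <;> linarith
  refine ⟨fun k i => if h : k < n ^ d ∧ i < d then
    a + (b - a) * (2 * ((finFunctionFinEquiv.symm ⟨k, h.1⟩ ⟨i, h.2⟩ : Fin n) : ℕ) + 1) / (2 * n)
    else a, ?_, ?_⟩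
  · intro k i
    dsimp only
    split_ifs with h
    · set m := (finFunctionFinEquiv.symm ⟨k, h.1⟩ ⟨i, h.2⟩ : Fin n)
      have hm : ((m : ℕ) : ℝ) + 1 ≤ n := by exact_mod_cast m.2
      constructor
      · have : 0 ≤ (b - a) * (2 * ((m : ℕ) : ℝ) + 1) / (2 * n) := by positivity
        linarith
      · have : (b - a) * (2 * ((m : ℕ) : ℝ) + 1) / (2 * n) ≤ b - a := by
          rw [div_le_iff₀ (by positivity)]
          exact mul_le_mul_of_nonneg_left (by linarith) hba.le
        linarith
    · exact ⟨le_rfl, hab.le⟩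
  · intro x hx
    choose m hm using fun i => hcell (x i) (hx i)
    refine ⟨finFunctionFinEquiv m, Fin.is_lt _, fun i => ?_⟩
    beta_reduce
    rw [dif_pos ⟨Fin.is_lt _, i.is_lt⟩, Fin.eta, Equiv.symm_apply_apply]
    exact hm i

/-- The positive and negative parts of the coordinates, enumerated in blocks of length `2 * d`,
sum up over the `k`-th block to an `ℓ¹`-distance. -/
theorem sum_block_eq_sum_abs {d k l : ℕ} (hd : 0 < d) (hl : 2 * d * (k + 1) ≤ l) (z : ℕ → ℕ → ℝ) :
    ∑ r ∈ Finset.range l, (if r / 2 / d = k then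
      max ((if r % 2 = 0 then (1 : ℝ) else -1) * z (r / 2 / d) (r / 2 % d)) 0 else 0)
      = ∑ i ∈ Finset.range d, |z k i| := by
  have habs : ∀ t : ℝ, |t| = ∑ s ∈ Finset.range 2,
      max ((if s = 0 then (1 : ℝ) else -1) * t) 0 := by
    intro t
    rw [Finset.sum_range_succ, Finset.sum_range_one]
    rcases le_total 0 t with h | h
    · simp [abs_of_nonneg h, h]
    · simp [abs_of_nonpos h, h]
  simp_rw [habs]
  rw [← Finset.sum_product', ← Finset.sum_filter]
  have hdiv : ∀ i < d, (d * k + i) / d = k ∧ (d * k + i) % d = i := fun i hi =>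
    ⟨by rw [Nat.mul_add_div hd, Nat.div_eq_of_lt hi, add_zero],
      by rw [Nat.mul_add_mod, Nat.mod_eq_of_lt hi]⟩
  refine Finset.sum_nbij' (fun r => (r / 2 % d, r % 2)) (fun q => 2 * (d * k + q.1) + q.2)
    ?_ ?_ ?_ ?_ ?_
  · intro r _
    simp only [Finset.mem_product, Finset.mem_range]
    exact ⟨Nat.mod_lt _ hd, Nat.mod_lt _ two_pos⟩
  · rintro ⟨i, s⟩ hq
    simp only [Finset.mem_product, Finset.mem_range] at hq
    have e : (2 * (d * k + i) + s) / 2 = d * k + i := by omega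
    simp only [Finset.mem_filter, Finset.mem_range, e, (hdiv i hq.1).1, and_true]
    nlinarith
  · intro r hr
    simp only [Finset.mem_filter] at hr
    have := Nat.div_add_mod (r / 2) d
    rw [hr.2] at this
    simp only [this]
    omega
  · rintro ⟨i, s⟩ hq
    simp only [Finset.mem_product, Finset.mem_range] at hq
    have e : (2 * (d * k + i) + s) / 2 = d * k + i := by omega
    have e' : (2 * (d * k + i) + s) % 2 = s := by omega
    simp only [e, e', (hdiv i hq.1).2]
  · intro r hr
    simp only [Finset.mem_filter] at hr
    rw [hr.2]

/-- Selecting a coordinate from a finite sum that may omit it only if it vanishes. -/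
theorem sum_range_ite_mul {l c : ℕ} {g : ℕ → ℝ} (h : l ≤ c → g c = 0) :
    ∑ j ∈ Finset.range l, (if j = c then (1 : ℝ) else 0) * g j = g c := by
  simp only [ite_mul, one_mul, zero_mul, Finset.sum_ite_eq', Finset.mem_range]
  split_ifs with hc
  · rfl
  · exact (h (not_lt.mp hc)).symm

/-- The number of grid cells per axis. -/
theorem exists_grid_size {d : ℕ} (hd : 0 < d) {A : ℝ} (hA : (6 : ℝ) ^ d < A) :
    ∃ n : ℕ, 0 < n ∧ A ^ ((1 : ℝ) / d) ≤ 3 * n ∧ (2 * d * n ^ d : ℝ) < A := by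
  have hA0 : 0 < A := lt_trans (by positivity) hA
  set T := A ^ ((1 : ℝ) / d) with hT
  have hTd : T ^ d = A := by
    rw [hT, one_div, Real.rpow_inv_natCast_pow hA0.le hd.ne']
  have hT0 : 0 ≤ T := Real.rpow_nonneg hA0.le _
  have hT6 : 6 < T := lt_of_pow_lt_pow_left₀ d hT0 (by rwa [hTd])
  refine ⟨⌈T / 3⌉₊, Nat.ceil_pos.mpr (by linarith), ?_, ?_⟩
  · linarith [Nat.le_ceil (T / 3)]
  · have h1 : (⌈T / 3⌉₊ : ℝ) < T / 2 := by
      linarith [Nat.ceil_lt_add_one (show 0 ≤ T / 3 by linarith)]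
    have h2 : (⌈T / 3⌉₊ : ℝ) ^ d < (T / 2) ^ d := pow_lt_pow_left₀ h1 (by positivity) hd.ne'
    have h3 : (2 * d : ℝ) ≤ 2 ^ d := by
      obtain ⟨e, rfl⟩ : ∃ e, d = e + 1 := ⟨d - 1, by omega⟩
      have : e + 1 ≤ 2 ^ e := Nat.lt_two_pow_self
      have : ((e + 1 : ℕ) : ℝ) ≤ 2 ^ e := by exact_mod_cast this
      rw [pow_succ]
      linarith
    calc (2 * d * (⌈T / 3⌉₊ : ℝ) ^ d : ℝ) < 2 * d * (T / 2) ^ d := by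
          have : (0 : ℝ) < d := by exact_mod_cast hd
          gcongr
      _ ≤ 2 ^ d * (T / 2) ^ d := by gcongr
      _ = A := by rw [← mul_pow, ← hTd]; congr 1; ring

/-- A network whose first two hidden layers compute `(c k - L * ‖x - y k‖₁)⁺` for `k < N` and
whose remaining layers compute the maximum of these values. -/
theorem exists_network_eq_runningMax {d N M D : ℕ} (hd : 0 < d) (hNM : N ≤ M + 1)
    {l : ℕ → ℕ} (hl0 : l 0 = d) (hl1 : 2 * d * N ≤ l 1)
    (hl : ∀ m ≤ M, 2 * N ≤ l (m + 2) + 2 * m ∧ 2 ≤ l (m + 2)) (hlL : l (M + 3) = 1)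
    (hdim : off l (M + 3) ≤ D) {y : ℕ → ℕ → ℝ} {c : ℕ → ℝ} {S L C : ℝ} (hC : 1 ≤ C)
    (hL : |L| ≤ C) (hS : |S| ≤ C) (hy : ∀ k i, |y k i| ≤ C) (hc : ∀ k, |c k| ≤ C) :
    ∃ ϑ : Fin D → ℝ, (∀ t, |ϑ t| ≤ C) ∧ ∀ x : Fin d → ℝ,
      affine (pad ϑ) (off l (M + 2)) (l (M + 3)) (l (M + 2))
        (hiddenLayers (pad ϑ) l (M + 2) (pad x)) 0
      = runningMax (fun k => if k < N then max (c k - L * ∑ i : Fin d, |x i - y k i|) 0 else 0)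
          (M + 1) - S := by
  have hC0 : 0 ≤ C := zero_le_one.trans hC
  let W : ℕ → ℕ → ℕ → ℝ
    | 0, r, j => if j = r / 2 % d then (if r % 2 = 0 then 1 else -1) else 0
    | 1, 0, _ => 0
    | 1, k + 1, j => if k < N then (if j / 2 / d = k then -L else 0) else 0
    | _ + 2, 0, j => (if j = 0 then 1 else 0) + (if j = 1 then 1 else 0) - (if j = 2 then 1 else 0)
    | _ + 2, r + 1, j => if j = r + 2 then 1 else 0
  let B : ℕ → ℕ → ℝ
    | 0, r => (if r % 2 = 0 then 1 else -1) * -y (r / 2 / d) (r / 2 % d)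
    | 1, 0 => 0
    | 1, k + 1 => if k < N then c k else 0
    | m + 2, _ => if m = M then -S else 0
  have hW : ∀ k i j, |W k i j| ≤ C := by
    rintro (_ | _ | k) (_ | i) j <;> simp only [W] <;> (try split_ifs) <;>
      first
      | omega
      | (simp; linarith)
  have hB : ∀ k i, |B k i| ≤ C := by
    rintro (_ | _ | k) (_ | i) <;> simp only [B] <;> (try split_ifs) <;> simp [hy, hc, hS, hC0]
  obtain ⟨ϑ, hϑ, haff⟩ := exists_affine_eq l W B hC0 hW hB hdim
  refine ⟨ϑ, hϑ, fun x => ?_⟩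
  set p : ℕ → ℝ :=
    fun k => if k < N then max (c k - L * ∑ i : Fin d, |x i - y k i|) 0 else 0 with hp
  have hp0 : ∀ k, N ≤ k → p k = 0 := fun k hk => if_neg (not_lt.mpr hk)
  have hpnonneg : ∀ k, 0 ≤ p k := by
    intro k
    simp only [hp]
    split_ifs
    exacts [le_max_right _ _, le_rfl]
  let q : ℕ → ℕ → ℝ
    | m, 0 => max (runningMax p m - p m) 0
    | m, r + 1 => p (m + r)
  have hq : ∀ m ≤ M, ∀ r, l (m + 2) ≤ r → q m r = 0 := by
    intro m hm r hr
    have := hl m hm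
    obtain ⟨r, rfl⟩ : ∃ s, r = s + 1 := ⟨r - 1, by omega⟩
    exact hp0 _ (by omega)
  have hmerge : ∀ m ≤ M, ∑ j ∈ Finset.range (l (m + 2)), W (m + 2) 0 j * q m j
      = runningMax p (m + 1) - p (m + 1) := by
    intro m hm
    simp only [W, add_mul, sub_mul, Finset.sum_add_distrib, Finset.sum_sub_distrib]
    rw [sum_range_ite_mul (hq m hm _), sum_range_ite_mul (hq m hm _),
      sum_range_ite_mul (hq m hm _)]
    simp only [q, runningMax, add_zero]
  have hstep : ∀ k < M + 3, ∀ r < l (k + 1), hiddenLayers (pad ϑ) l (k + 1) (pad x) r =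
      max (∑ j ∈ Finset.range (l k), W k r j * hiddenLayers (pad ϑ) l k (pad x) j + B k r) 0 := by
    intro k hk r hr
    simp only [hiddenLayers]
    rw [haff k hk r hr]
  have hfirst : ∀ r < l 1, hiddenLayers (pad ϑ) l 1 (pad x) r =
      max ((if r % 2 = 0 then (1 : ℝ) else -1) *
        (pad x (r / 2 % d) - y (r / 2 / d) (r / 2 % d))) 0 := by
    intro r hr
    rw [hstep 0 (by omega) r hr]
    congr 1
    simp only [W, B, hiddenLayers, hl0, ite_mul, zero_mul, Finset.sum_ite_eq', Finset.mem_range,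
      Nat.mod_lt _ hd, if_true]
    split_ifs <;> ring
  have hlayers : ∀ m ≤ M, ∀ r < l (m + 2),
      hiddenLayers (pad ϑ) l (m + 2) (pad x) r = q m r := by
    intro m
    induction m with
    | zero =>
      intro _ r hr
      rw [hstep 1 (by omega) r hr, Finset.sum_congr rfl fun j hj => by
        rw [hfirst j (Finset.mem_range.mp hj)]]
      rcases r with _ | k
      · simp [W, B, q, runningMax, hpnonneg]
      · by_cases hk : k < N
        · have hblock := sum_block_eq_sum_abs (l := l 1) (k := k) hd
            ((Nat.mul_le_mul_left _ hk).trans hl1) fun k i => pad x i - y k i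
          have hpad : ∑ i ∈ Finset.range d, |pad x i - y k i| = ∑ i : Fin d, |x i - y k i| := by
            rw [Finset.sum_range]
            simp [pad]
          rw [hpad] at hblock
          simp only [W, B, q, hp, hk, if_true, zero_add]
          rw [← hblock, Finset.mul_sum]
          congr 1
          rw [sub_eq_neg_add, ← Finset.sum_neg_distrib]
          congr 1
          refine Finset.sum_congr rfl fun j _ => ?_
          split_ifs <;> ring
        · simp [W, B, q, hk, hp]
    | succ m ih =>
      intro hm r hr
      rw [hstep (m + 2) (by omega) r hr, Finset.sum_congr rfl fun j hj => by
        rw [ih (by omega) j (Finset.mem_range.mp hj)]]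
      have hB0 : B (m + 2) r = 0 := if_neg (by omega)
      rw [hB0, add_zero]
      rcases r with _ | r
      · rw [hmerge m (by omega)]
      · simp only [W]
        rw [sum_range_ite_mul (hq m (by omega) _)]
        have e : m + 1 + r = m + (r + 1) := by omega
        simp only [q, e]
        exact max_eq_left (hpnonneg _)
  rw [haff (M + 2) (by omega) 0 (by rw [hlL]; exact one_pos), Finset.sum_congr rfl fun j hj => by
    rw [hlayers M le_rfl j (Finset.mem_range.mp hj)], hmerge M le_rfl, hp0 (M + 1) hNM]
  simp [B, sub_eq_add_neg]

theorem stmt2 (d dd LL : ℕ) (hd : 0 < d) (hdd : 0 < dd) (hLL : 0 < LL)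
    (A : ℝ) (hA : 0 < A) (L a b : ℝ) (hab : a < b)
    (u v : EReal) (hu : u < ⊤) (huv : u < v)
    (l : ℕ → ℕ) (hl : ∀ i, i ≤ LL → 0 < l i) (hl0 : l 0 = d) (hlL : l LL = 1)
    (harchL : (if (6 : ℝ) ^ d < A then A else 0) / (2 * d) + 1 ≤ (LL : ℝ))
    (harch1 : (if (6 : ℝ) ^ d < A then A else 0) ≤ (l 1 : ℝ))
    (harchi : ∀ i : ℕ, 2 ≤ i → i < LL →
      (if (6 : ℝ) ^ d < A then (1 : ℝ) else 0) * max (A / d - 2 * i + 3) 2 ≤ (l i : ℝ))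
    (hdim : ∑ i ∈ Finset.range LL, l (i + 1) * (l i + 1) ≤ dd)
    (f : (Fin d → ℝ) → ℝ)
    (hf : ∀ x : Fin d → ℝ, (∀ i, x i ∈ Set.Icc a b) →
      u ≤ (f x : EReal) ∧ (f x : EReal) ≤ v)
    (hfLip : ∀ x y : Fin d → ℝ, (∀ i, x i ∈ Set.Icc a b) → (∀ i, y i ∈ Set.Icc a b) →
      |f x - f y| ≤ L * ∑ i, |x i - y i|) :
    ∃ ϑ : Fin dd → ℝ,
      (∀ i, |ϑ i| ≤ max 1 (max L (max |a| (max |b|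
        (2 * ⨆ x : {z : Fin d → ℝ // ∀ i, z i ∈ Set.Icc a b}, |f x.1|))))) ∧
      ∀ x : Fin d → ℝ, (∀ i, x i ∈ Set.Icc a b) →
        |dnnE (pad ϑ) l LL u v (pad x) - f x| ≤ 3 * d * L * (b - a) / A ^ ((1 : ℝ) / d) := by
  set S := ⨆ x : {z : Fin d → ℝ // ∀ i, z i ∈ Set.Icc a b}, |f x.1| with hSdef
  set C := max 1 (max L (max |a| (max |b| (2 * S)))) with hCdef
  have hC1 : 1 ≤ C := le_max_left _ _
  have hCL : L ≤ C := (le_max_left _ _).trans (le_max_right _ _)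
  have hCa : |a| ≤ C := (le_max_left _ _).trans ((le_max_right _ _).trans (le_max_right _ _))
  have hCb : |b| ≤ C := (le_max_left _ _).trans ((le_max_right _ _).trans
    ((le_max_right _ _).trans (le_max_right _ _)))
  have hCS : 2 * S ≤ C := (le_max_right _ _).trans ((le_max_right _ _).trans
    ((le_max_right _ _).trans (le_max_right _ _)))
  have hd' : (0 : ℝ) < d := by exact_mod_cast hd
  have hba : 0 < b - a := sub_pos.mpr hab
  have hL0 : 0 ≤ L := by
    have h := (abs_nonneg _).trans (hfLip (fun _ => a) (fun _ => b)
      (fun _ => ⟨le_rfl, hab.le⟩) (fun _ => ⟨hab.le, le_rfl⟩))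
    have hpos : 0 < ∑ _i : Fin d, |a - b| := by
      simp only [Finset.sum_const, Finset.card_univ, Fintype.card_fin, nsmul_eq_mul]
      exact mul_pos hd' (abs_pos.mpr (by linarith))
    exact nonneg_of_mul_nonneg_left h hpos
  have hmid : ∀ _i : Fin d, (a + b) / 2 ∈ Set.Icc a b := fun _ =>
    ⟨by linarith, by linarith⟩
  have hfmid : ∀ x : Fin d → ℝ, (∀ i, x i ∈ Set.Icc a b) →
      |f x - f fun _ => (a + b) / 2| ≤ L * (d * ((b - a) / 2)) := by
    intro x hx
    refine (hfLip x _ hx hmid).trans (mul_le_mul_of_nonneg_left ?_ hL0)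
    calc ∑ i, |x i - (a + b) / 2| ≤ ∑ _i : Fin d, (b - a) / 2 :=
          Finset.sum_le_sum fun i _ =>
            abs_le.mpr ⟨by linarith [(hx i).1], by linarith [(hx i).2]⟩
      _ = d * ((b - a) / 2) := by simp
  have hfS : ∀ x : Fin d → ℝ, (∀ i, x i ∈ Set.Icc a b) → |f x| ≤ S := by
    intro x hx
    have hbdd : BddAbove (Set.range
        fun x : {z : Fin d → ℝ // ∀ i, z i ∈ Set.Icc a b} => |f x.1|) := by
      refine ⟨L * (d * ((b - a) / 2)) + |f fun _ => (a + b) / 2|, ?_⟩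
      rintro _ ⟨z, rfl⟩
      linarith [hfmid z.1 z.2, abs_sub_abs_le_abs_sub (f z.1) (f fun _ => (a + b) / 2)]
    exact le_ciSup hbdd ⟨x, hx⟩
  have hS0 : 0 ≤ S := (abs_nonneg _).trans (hfS _ hmid)
  have hT0 : 0 < A ^ ((1 : ℝ) / d) := Real.rpow_pos_of_pos hA _
  by_cases hA6 : (6 : ℝ) ^ d < A
  · simp only [if_pos hA6, one_mul] at harchL harch1 harchi
    obtain ⟨n, hn, hAn, hnA⟩ := exists_grid_size hd hA6
    have hn' : (0 : ℝ) < n := by exact_mod_cast hn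
    obtain ⟨y, hy, hcover⟩ := exists_grid d n hn hab
    have hN : 0 < n ^ d := pow_pos hn d
    have hAd : 2 * ((n ^ d : ℕ) : ℝ) < A / d := by
      rw [lt_div_iff₀ hd']
      push_cast
      linarith
    have hdepth : n ^ d + 1 < LL := by
      have : ((n ^ d + 1 : ℕ) : ℝ) < LL := by
        have e : A / (2 * d) = A / d / 2 := by field_simp
        push_cast at hAd ⊢
        linarith
      exact_mod_cast this
    obtain ⟨M, rfl⟩ : ∃ M, LL = M + 3 := ⟨LL - 3, by omega⟩
    have hl1 : 2 * d * n ^ d ≤ l 1 := by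
      have : ((2 * d * n ^ d : ℕ) : ℝ) ≤ l 1 := by
        push_cast
        linarith
      exact_mod_cast this
    have hlm : ∀ m ≤ M, 2 * n ^ d ≤ l (m + 2) + 2 * m ∧ 2 ≤ l (m + 2) := by
      intro m hm
      have h := max_le_iff.mp (harchi (m + 2) (by omega) (by omega))
      refine ⟨?_, by exact_mod_cast h.2⟩
      have : ((2 * n ^ d : ℕ) : ℝ) < (l (m + 2) + 2 * m + 1 : ℕ) := by
        have h1 := h.1
        push_cast at h1 hAd ⊢
        linarith
      have : 2 * n ^ d < l (m + 2) + 2 * m + 1 := by exact_mod_cast this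
      omega
    have hfy : ∀ k, |f fun i : Fin d => y k i| ≤ S := fun k => hfS _ fun i => hy k i
    obtain ⟨ϑ, hϑ, hnet⟩ := exists_network_eq_runningMax (S := S) (L := L) (C := C)
      (c := fun k => f (fun i : Fin d => y k i) + S) hd (by omega) hl0 hl1 hlm hlL hdim hC1
      (by rwa [abs_of_nonneg hL0]) (by rw [abs_of_nonneg hS0]; linarith)
      (fun k i => (abs_le_max_abs_abs (hy k i).1 (hy k i).2).trans (max_le hCa hCb))
      (fun k => by
        have := abs_le.mp (hfy k)
        rw [abs_of_nonneg (by linarith)]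
        linarith)
    refine ⟨ϑ, hϑ, fun x hx => (abs_toReal_clip_sub_le (hf x hx).1 (hf x hx).2 _).trans ?_⟩
    rw [show M + 3 - 1 = M + 2 from rfl, hnet x]
    set p : ℕ → ℝ := fun k => if k < n ^ d then
      max (f (fun i : Fin d => y k i) + S - L * ∑ i : Fin d, |x i - y k i|) 0 else 0 with hp
    have hfx := abs_le.mp (hfS x hx)
    have hupper : runningMax p (M + 1) ≤ f x + S := by
      refine runningMax_le (by linarith) (fun k => ?_) _
      simp only [hp]
      split_ifs
      · refine max_le ?_ (by linarith)
        have h := (abs_le.mp (hfLip x (fun i => y k i) hx fun i => hy k i)).1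
        linarith
      · linarith
    have hlower : f x + S - d * L * (b - a) / n ≤ runningMax p (M + 1) := by
      obtain ⟨k, hk, hxk⟩ := hcover x hx
      refine le_trans ?_ (le_runningMax p (show k < M + 1 by omega))
      simp only [hp, if_pos hk]
      refine le_max_of_le_left ?_
      have h := (abs_le.mp (hfLip x (fun i => y k i) hx fun i => hy k i)).2
      have hsum : ∑ i : Fin d, |x i - y k i| ≤ d * ((b - a) / (2 * n)) :=
        (Finset.sum_le_sum fun i _ => hxk i).trans (by simp)
      have hLsum := mul_le_mul_of_nonneg_left hsum hL0
      have e : d * L * (b - a) / n = 2 * (L * (d * ((b - a) / (2 * n)))) := by field_simp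
      linarith
    have herr : d * L * (b - a) / n ≤ 3 * d * L * (b - a) / A ^ ((1 : ℝ) / d) := by
      rw [div_le_div_iff₀ hn' hT0]
      have : 0 ≤ d * L * (b - a) := by positivity
      nlinarith
    rw [abs_le]
    constructor <;> linarith [show 0 ≤ d * L * (b - a) / n by positivity]
  · obtain ⟨K, rfl⟩ : ∃ K, LL = K + 1 := ⟨LL - 1, by omega⟩
    set c := f fun _ => (a + b) / 2
    obtain ⟨ϑ, hϑ, haff⟩ := exists_affine_eq l (fun _ _ _ => 0)
      (fun k _ => if k = K then c else 0) (zero_le_one.trans hC1)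
      (fun _ _ _ => by simpa using zero_le_one.trans hC1)
      (fun k _ => by
        split_ifs
        · linarith [hfS _ hmid]
        · simpa using zero_le_one.trans hC1) hdim
    refine ⟨ϑ, hϑ, fun x hx => (abs_toReal_clip_sub_le (hf x hx).1 (hf x hx).2 _).trans ?_⟩
    rw [Nat.add_sub_cancel, haff K (Nat.lt_succ_self K) 0 (hl _ le_rfl)]
    simp only [zero_mul, Finset.sum_const_zero, zero_add, if_true]
    rw [abs_sub_comm]
    refine (hfmid x hx).trans ?_
    have hT6 : A ^ ((1 : ℝ) / d) ≤ 6 := by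
      refine (pow_le_pow_iff_left₀ hT0.le (by norm_num) hd.ne').mp ?_
      rw [one_div, Real.rpow_inv_natCast_pow hA.le hd.ne']
      exact not_lt.mp hA6
    rw [le_div_iff₀ hT0]
    have : 0 ≤ L * (d * ((b - a) / 2)) := by positivity
    nlinarith
end

section
/- Let (E,δ) be a separable metric space, let N ∈ ℕ, p, L, r₁,…,r_N ∈ [0,∞), z₁,…,z_N ∈ E satisfy E ⊆ ⋃_{i=1}^N {x ∈ E : δ(x,z_i) ≤ r_i}, let (Ω,𝓕,μ) be a measure space, let Z_x : Ω → ℝ, x ∈ E, be 𝓕/𝓑(ℝ)-measurable functions, and assume for all ω ∈ Ω and all x, y ∈ E that |Z_x(ω) − Z_y(ω)| ≤ L·δ(x,y). Then ∫_Ω sup_{x ∈ E} |Z_x(ω)|^p μ(dω) ≤ Σ_{i=1}^N ∫_Ω (L·r_i + |Z_{z_i}(ω)|)^p μ(dω). -/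
open MeasureTheory
open scoped ENNReal

theorem stmt4 {E : Type*} [MetricSpace E] [TopologicalSpace.SeparableSpace E]
    (N : ℕ) (hN : 0 < N) (p L : ℝ) (hp : 0 ≤ p) (hL : 0 ≤ L)
    (r : Fin N → ℝ) (hr : ∀ i, 0 ≤ r i) (z : Fin N → E)
    (hcover : ∀ x : E, ∃ i, dist x (z i) ≤ r i)
    {Ω : Type*} [MeasurableSpace Ω] (μ : Measure Ω)
    (Z : E → Ω → ℝ) (hZmeas : ∀ x, Measurable (Z x))
    (hZlip : ∀ (ω : Ω) (x y : E), |Z x ω - Z y ω| ≤ L * dist x y) :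
    ∫⁻ ω, (⨆ x : E, ENNReal.ofReal |Z x ω|) ^ p ∂μ ≤
      ∑ i : Fin N, ∫⁻ ω, (ENNReal.ofReal (L * r i + |Z (z i) ω|)) ^ p ∂μ := by
  have hmeas : ∀ i ∈ Finset.univ, Measurable fun ω =>
      (ENNReal.ofReal (L * r i + |Z (z i) ω|)) ^ p := fun i _ =>
    (((hZmeas (z i)).abs.const_add (L * r i)).ennreal_ofReal).pow_const p
  rw [← lintegral_finsetSum _ hmeas]
  refine lintegral_mono fun ω => ?_
  have : Nonempty (Fin N) := ⟨⟨0, hN⟩⟩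
  obtain ⟨j, hj⟩ := Finite.exists_max fun i => ENNReal.ofReal (L * r i + |Z (z i) ω|)
  have hsup : ⨆ x : E, ENNReal.ofReal |Z x ω| ≤ ENNReal.ofReal (L * r j + |Z (z j) ω|) := by
    refine iSup_le fun x => ?_
    obtain ⟨i, hi⟩ := hcover x
    refine (ENNReal.ofReal_le_ofReal ?_).trans (hj i)
    linarith [hZlip ω x (z i), mul_le_mul_of_nonneg_left hi hL,
      abs_sub_abs_le_abs_sub (Z x ω) (Z (z i) ω)]
  exact (ENNReal.rpow_le_rpow hsup hp).trans <|
    Finset.single_le_sum (f := fun i => (ENNReal.ofReal (L * r i + |Z (z i) ω|)) ^ p)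
      (fun _ _ => zero_le) (Finset.mem_univ j)
end

section
/- Let p, L, r ∈ (0,∞), let (E,δ) be a nonempty separable metric space, let (Ω,𝓕,μ) be a measure space with μ(Ω) ≠ 0, let Z_x : Ω → ℝ, x ∈ E, be 𝓕/𝓑(ℝ)-measurable functions, and assume for all ω ∈ Ω and all x, y ∈ E that |Z_x(ω) − Z_y(ω)| ≤ L·δ(x,y). Then ∫_Ω sup_{x ∈ E} |Z_x(ω)|^p μ(dω) ≤ 𝒞_{(E,δ),r} · sup_{x ∈ E} ∫_Ω (L·r + |Z_x(ω)|)^p μ(dω). -/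
open MeasureTheory
open scoped ENNReal

/-- The covering number of a set `E` with respect to a distance function `δ` and radius `r`. -/
noncomputable def coveringNumber {E : Type*} (δ : E → E → ℝ) (r : ℝ) : ℕ∞ :=
  ⨅ (A : Finset E) (_ : ∀ x : E, ∃ a ∈ A, δ a x ≤ r), (A.card : ℕ∞)

theorem exists_finset_card_eq_coveringNumber {E : Type*} {δ : E → E → ℝ} {r : ℝ}
    (h : coveringNumber δ r ≠ ⊤) :
    ∃ A : Finset E, (∀ x : E, ∃ a ∈ A, δ a x ≤ r) ∧ (A.card : ℕ∞) = coveringNumber δ r := by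
  rw [coveringNumber, iInf_subtype'] at *
  have hne : Nonempty {A : Finset E // ∀ x : E, ∃ a ∈ A, δ a x ≤ r} := by
    by_contra hempty
    rw [not_nonempty_iff] at hempty
    exact h (iInf_of_empty _)
  obtain ⟨A, hA⟩ := ciInf_mem
    (fun A : {A : Finset E // ∀ x : E, ∃ a ∈ A, δ a x ≤ r} => (A.1.card : ℕ∞))
  exact ⟨A.1, A.2, hA⟩

theorem iSup_rpow_le_sum_of_cover {E : Type*} [PseudoMetricSpace E] {p L r : ℝ} (hp : 0 < p)
    (hL : 0 ≤ L) {f : E → ℝ} (hf : ∀ x y : E, |f x - f y| ≤ L * dist x y) {A : Finset E}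
    (hA : ∀ x : E, ∃ a ∈ A, dist a x ≤ r) :
    (⨆ x : E, ENNReal.ofReal |f x|) ^ p ≤ ∑ a ∈ A, ENNReal.ofReal (L * r + |f a|) ^ p := by
  rw [← ENNReal.le_rpow_inv_iff hp]
  refine iSup_le fun x => ?_
  rw [ENNReal.le_rpow_inv_iff hp]
  obtain ⟨a, ha, hax⟩ := hA x
  have hle : |f x| ≤ L * r + |f a| := by
    have h₁ : |f x - f a| ≤ L * r :=
      (hf x a).trans (mul_le_mul_of_nonneg_left (by rwa [dist_comm]) hL)
    linarith [abs_sub_abs_le_abs_sub (f x) (f a)]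
  calc ENNReal.ofReal |f x| ^ p ≤ ENNReal.ofReal (L * r + |f a|) ^ p := by gcongr
    _ ≤ _ := Finset.single_le_sum (f := fun a => ENNReal.ofReal (L * r + |f a|) ^ p)
      (fun _ _ => zero_le) ha

theorem stmt5 {E : Type*} [MetricSpace E] [TopologicalSpace.SeparableSpace E] [Nonempty E]
    (p L r : ℝ) (hp : 0 < p) (hL : 0 < L) (hr : 0 < r)
    {Ω : Type*} [MeasurableSpace Ω] (μ : Measure Ω) (hμ : μ ≠ 0)
    (Z : E → Ω → ℝ) (hZmeas : ∀ x, Measurable (Z x))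
    (hZlip : ∀ (ω : Ω) (x y : E), |Z x ω - Z y ω| ≤ L * dist x y) :
    ∫⁻ ω, (⨆ x : E, ENNReal.ofReal |Z x ω|) ^ p ∂μ ≤
      (coveringNumber (fun x y : E => dist x y) r : ℝ≥0∞) *
        ⨆ x : E, ∫⁻ ω, (ENNReal.ofReal (L * r + |Z x ω|)) ^ p ∂μ := by
  by_cases hcov : coveringNumber (fun x y : E => dist x y) r = ⊤
  · obtain ⟨x₀⟩ := ‹Nonempty E›
    have hpos : ∀ ω, 0 < L * r + |Z x₀ ω| := fun ω => by positivity
    have hmeas : Measurable fun ω => ENNReal.ofReal (L * r + |Z x₀ ω|) ^ p :=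
      (((hZmeas x₀).abs.const_add _).ennreal_ofReal).pow_const p
    have hint : ∫⁻ ω, ENNReal.ofReal (L * r + |Z x₀ ω|) ^ p ∂μ ≠ 0 := by
      rw [Ne, lintegral_eq_zero_iff hmeas]
      intro hzero
      refine hμ (ae_eq_bot.mp (Filter.eventually_false_iff_eq_bot.mp ?_))
      filter_upwards [hzero] with ω hω
      exact (ENNReal.rpow_pos (ENNReal.ofReal_pos.mpr (hpos ω)) ENNReal.ofReal_ne_top).ne' hω
    have hsup : (⨆ x : E, ∫⁻ ω, ENNReal.ofReal (L * r + |Z x ω|) ^ p ∂μ) ≠ 0 := fun hzero =>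
      hint (ENNReal.iSup_eq_zero.mp hzero x₀)
    rw [hcov, ENat.toENNReal_top, ENNReal.top_mul hsup]
    exact le_top
  · obtain ⟨A, hA, hcard⟩ := exists_finset_card_eq_coveringNumber hcov
    rw [← hcard, ENat.toENNReal_coe]
    calc ∫⁻ ω, (⨆ x : E, ENNReal.ofReal |Z x ω|) ^ p ∂μ
        ≤ ∫⁻ ω, ∑ a ∈ A, ENNReal.ofReal (L * r + |Z a ω|) ^ p ∂μ :=
          lintegral_mono fun ω => iSup_rpow_le_sum_of_cover hp hL.le (hZlip ω) hA
      _ = ∑ a ∈ A, ∫⁻ ω, ENNReal.ofReal (L * r + |Z a ω|) ^ p ∂μ :=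
          lintegral_finsetSum _ fun a _ =>
            (((hZmeas a).abs.const_add _).ennreal_ofReal).pow_const p
      _ ≤ A.card • ⨆ x : E, ∫⁻ ω, ENNReal.ofReal (L * r + |Z x ω|) ^ p ∂μ :=
          Finset.sum_le_card_nsmul _ _ _ fun a _ =>
            le_iSup (fun x => ∫⁻ ω, ENNReal.ofReal (L * r + |Z x ω|) ^ p ∂μ) a
      _ = _ := nsmul_eq_mul _ _
end

section
/- Let Γ : (0,∞) → (0,∞) denote the Gamma function Γ(x) = ∫₀^∞ t^{x−1} e^{−t} dt. Then for all x ∈ (0,∞) and α ∈ [0,1]: (max{x+α−1, 0})^α ≤ x/(x+α)^{1−α} ≤ Γ(x+α)/Γ(x) ≤ x^α. -/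
theorem Real.Gamma_add_le_rpow_mul_Gamma {x a : ℝ} (hx : 0 < x) (ha : a ∈ Set.Icc (0 : ℝ) 1) :
    Real.Gamma (x + a) ≤ x ^ a * Real.Gamma x := by
  obtain ⟨h0, h1⟩ := ha
  rcases h0.eq_or_lt with rfl | h0
  · simp
  rcases h1.eq_or_lt with rfl | h1
  · rw [Real.Gamma_add_one hx.ne', Real.rpow_one]
  have hΓ := Real.Gamma_pos_of_pos hx
  calc Real.Gamma (x + a) = Real.Gamma ((1 - a) * x + a * (x + 1)) := by ring_nf
    _ ≤ Real.Gamma x ^ (1 - a) * Real.Gamma (x + 1) ^ a :=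
      Real.Gamma_mul_add_mul_le_rpow_Gamma_mul_rpow_Gamma hx (by linarith) (by linarith) h0
        (by ring)
    _ = x ^ a * (Real.Gamma x ^ (1 - a) * Real.Gamma x ^ a) := by
      rw [Real.Gamma_add_one hx.ne', Real.mul_rpow hx.le hΓ.le]
      ring
    _ = x ^ a * Real.Gamma x := by
      rw [← Real.rpow_add hΓ, sub_add_cancel, Real.rpow_one]

theorem stmt12 (x : ℝ) (hx : 0 < x) (α : ℝ) (hα : α ∈ Set.Icc (0 : ℝ) 1) :
    (max (x + α - 1) 0) ^ α ≤ x / (x + α) ^ (1 - α)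
    ∧ x / (x + α) ^ (1 - α) ≤ Real.Gamma (x + α) / Real.Gamma x
    ∧ Real.Gamma (x + α) / Real.Gamma x ≤ x ^ α := by
  have hΓ := Real.Gamma_pos_of_pos hx
  have hxα : 0 < x + α := by linarith [hα.1]
  have hpow : 0 < (x + α) ^ (1 - α) := Real.rpow_pos_of_pos hxα _
  refine ⟨?_, ?_, ?_⟩
  · rw [le_div_iff₀ hpow]
    rcases le_total 0 (x + α - 1) with h | h
    · rw [max_eq_left h]
      linarith [Real.geom_mean_le_arith_mean2_weighted hα.1 (sub_nonneg.2 hα.2) h hxα.le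
        (by ring)]
    · rw [max_eq_right h]
      rcases hα.1.eq_or_lt with rfl | h0
      · simp
      · rw [Real.zero_rpow h0.ne', zero_mul]
        exact hx.le
  · rw [div_le_div_iff₀ hpow hΓ, ← Real.Gamma_add_one hx.ne', mul_comm (Real.Gamma _)]
    have h := Real.Gamma_add_le_rpow_mul_Gamma hxα
      (show 1 - α ∈ Set.Icc (0 : ℝ) 1 from ⟨sub_nonneg.2 hα.2, sub_le_self 1 hα.1⟩)
    rwa [show x + α + (1 - α) = x + 1 by ring] at h
  · rw [div_le_iff₀ hΓ]
    exact Real.Gamma_add_le_rpow_mul_Gamma hx hα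
end

section
/- Let Γ : (0,∞) → (0,∞) denote the Gamma function Γ(x) = ∫₀^∞ t^{x−1} e^{−t} dt. Then for all x ∈ (0,∞) and α ∈ [0,∞): (max{x + min{α−1, 0}, 0})^α ≤ Γ(x+α)/Γ(x) ≤ (x + max{α−1, 0})^α. -/
open Real Set

lemma log_Gamma_add_one {x : ℝ} (hx : 0 < x) :
    log (Gamma (x + 1)) - log (Gamma x) = log x := by
  rw [Gamma_add_one hx.ne', log_mul hx.ne' (Gamma_pos_of_pos hx).ne']
  ring

lemma Gamma_div_le_rpow_iff {x y α : ℝ} (hx : 0 < x) (hy : 0 < y) (hα : 0 < α) :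
    Gamma (x + α) / Gamma x ≤ y ^ α ↔ (log (Gamma (x + α)) - log (Gamma x)) / α ≤ log y := by
  have hΓ := Gamma_pos_of_pos hx
  have hΓα := Gamma_pos_of_pos (add_pos hx hα)
  rw [← log_le_log_iff (by positivity) (by positivity), log_div hΓα.ne' hΓ.ne',
    log_rpow hy, div_le_iff₀ hα, mul_comm]

lemma rpow_le_Gamma_div_iff {x y α : ℝ} (hx : 0 < x) (hy : 0 < y) (hα : 0 < α) :
    y ^ α ≤ Gamma (x + α) / Gamma x ↔ log y ≤ (log (Gamma (x + α)) - log (Gamma x)) / α := by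
  have hΓ := Gamma_pos_of_pos hx
  have hΓα := Gamma_pos_of_pos (add_pos hx hα)
  rw [← log_le_log_iff (by positivity) (by positivity), log_div hΓα.ne' hΓ.ne',
    log_rpow hy, le_div_iff₀ hα, mul_comm]

lemma Gamma_div_le_rpow_of_le_one {x α : ℝ} (hx : 0 < x) (hα : 0 < α) (h : α ≤ 1) :
    Gamma (x + α) / Gamma x ≤ x ^ α := by
  rw [Gamma_div_le_rpow_iff hx hx hα, ← log_Gamma_add_one hx]
  simpa using convexOn_log_Gamma.secant_mono (a := x) (x := x + α) (y := x + 1) hx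
    (add_pos hx hα) (add_pos hx one_pos) (by linarith) (by linarith) (by linarith)

lemma rpow_le_Gamma_div_of_one_le {x α : ℝ} (hx : 0 < x) (h : 1 ≤ α) :
    x ^ α ≤ Gamma (x + α) / Gamma x := by
  have hα : 0 < α := by linarith
  rw [rpow_le_Gamma_div_iff hx hx hα, ← log_Gamma_add_one hx]
  simpa using convexOn_log_Gamma.secant_mono (a := x) (x := x + 1) (y := x + α) hx
    (add_pos hx one_pos) (add_pos hx hα) (by linarith) (by linarith) (by linarith)

lemma Gamma_div_le_rpow_of_one_le {x α : ℝ} (hx : 0 < x) (h : 1 ≤ α) :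
    Gamma (x + α) / Gamma x ≤ (x + (α - 1)) ^ α := by
  have hα : 0 < α := by linarith
  have hy : 0 < x + (α - 1) := by linarith
  have key := convexOn_log_Gamma.secant_mono (a := x + α) (x := x) (y := x + (α - 1))
    (add_pos hx hα) hx hy (by linarith) (by linarith) (by linarith)
  rw [← neg_div_neg_eq, ← neg_div_neg_eq (_ - _) (x + (α - 1) - (x + α))] at key
  rw [Gamma_div_le_rpow_iff hx hy hα, ← log_Gamma_add_one hy]
  simpa [add_assoc] using key

lemma rpow_le_Gamma_div_of_le_one {x α : ℝ} (hx : 0 < x) (hα : 0 < α) (h : α ≤ 1)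
    (hy : 0 < x + (α - 1)) :
    (x + (α - 1)) ^ α ≤ Gamma (x + α) / Gamma x := by
  have key := convexOn_log_Gamma.secant_mono (a := x + α) (x := x + (α - 1)) (y := x)
    (add_pos hx hα) hy hx (by linarith) (by linarith) (by linarith)
  rw [← neg_div_neg_eq, ← neg_div_neg_eq (_ - _) (x - (x + α))] at key
  rw [rpow_le_Gamma_div_iff hx hy hα, ← log_Gamma_add_one hy]
  simpa [add_assoc] using key

theorem stmt13 (x : ℝ) (hx : 0 < x) (α : ℝ) (hα : 0 ≤ α) :
    (max (x + min (α - 1) 0) 0) ^ α ≤ Real.Gamma (x + α) / Real.Gamma x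
    ∧ Real.Gamma (x + α) / Real.Gamma x ≤ (x + max (α - 1) 0) ^ α := by
  rcases hα.eq_or_lt with rfl | hα
  · simp [(Gamma_pos_of_pos hx).ne']
  rcases le_total α 1 with h | h
  · rw [min_eq_left (by linarith), max_eq_right (sub_nonpos.2 h), add_zero]
    refine ⟨?_, Gamma_div_le_rpow_of_le_one hx hα h⟩
    rcases le_or_gt (x + (α - 1)) 0 with hy | hy
    · rw [max_eq_right hy, zero_rpow hα.ne']
      exact (div_pos (Gamma_pos_of_pos (add_pos hx hα)) (Gamma_pos_of_pos hx)).le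
    · rw [max_eq_left hy.le]
      exact rpow_le_Gamma_div_of_le_one hx hα h hy
  · rw [min_eq_right (by linarith), max_eq_left (sub_nonneg.2 h), add_zero, max_eq_left hx.le]
    exact ⟨rpow_le_Gamma_div_of_one_le hx h, Gamma_div_le_rpow_of_one_le hx h⟩
end

section
/- Let B : (0,∞)² → (0,∞) be the Beta function B(x,y) = ∫₀¹ t^{x−1}(1−t)^{y−1} dt and let Γ be the Gamma function Γ(x) = ∫₀^∞ t^{x−1} e^{−t} dt. Then for all x, y ∈ (0,∞) with x + y > 1: Γ(x)/(y + max{x−1, 0})^x ≤ B(x,y) ≤ Γ(x)/(y + min{x−1, 0})^x ≤ max{1, x^x}/(x·(y + min{x−1, 0})^x). -/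
/-- The Beta function `B(x,y) = ∫₀¹ t^(x-1) (1-t)^(y-1) dt`. -/
noncomputable def betaFn (x y : ℝ) : ℝ := ∫ t in (0 : ℝ)..1, t ^ (x - 1) * (1 - t) ^ (y - 1)

/-- Weighted log-convexity of `Γ` on the positive reals. -/
theorem log_Gamma_convex_comb {s t a : ℝ} (hs : 0 < s) (ht : 0 < t) (ha : 0 ≤ a) (ha1 : a ≤ 1) :
    Real.log (Real.Gamma (a * s + (1 - a) * t))
      ≤ a * Real.log (Real.Gamma s) + (1 - a) * Real.log (Real.Gamma t) := by
  simpa using Real.convexOn_log_Gamma.2 hs ht ha (sub_nonneg.2 ha1) (by ring)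

theorem log_Gamma_add_one_s14 {s : ℝ} (hs : 0 < s) :
    Real.log (Real.Gamma (s + 1)) = Real.log s + Real.log (Real.Gamma s) := by
  rw [Real.Gamma_add_one hs.ne', Real.log_mul hs.ne' (Real.Gamma_pos_of_pos hs).ne']

theorem log_rpow_mul_Gamma {c x y : ℝ} (hc : 0 < c) (hy : 0 < y) :
    Real.log (c ^ x * Real.Gamma y) = x * Real.log c + Real.log (Real.Gamma y) := by
  rw [Real.log_mul (Real.rpow_pos_of_pos hc x).ne' (Real.Gamma_pos_of_pos hy).ne',
    Real.log_rpow hc]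

/-- Upper bound for a ratio of Gamma values. -/
theorem Gamma_add_le {x y : ℝ} (hx : 0 < x) (hy : 0 < y) :
    Real.Gamma (x + y) ≤ (y + max (x - 1) 0) ^ x * Real.Gamma y := by
  have hc : 0 < y + max (x - 1) 0 := by positivity
  have hG := Real.Gamma_pos_of_pos hy
  rw [← Real.log_le_log_iff (Real.Gamma_pos_of_pos (add_pos hx hy)) (by positivity),
    log_rpow_mul_Gamma hc hy]
  rcases le_total x 1 with h | h
  · rw [max_eq_right (by linarith), add_zero]
    have key := log_Gamma_convex_comb (show 0 < y + 1 by linarith) hy hx.le h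
    rw [show x * (y + 1) + (1 - x) * y = x + y by ring, log_Gamma_add_one_s14 hy] at key
    linarith
  · rw [max_eq_left (by linarith)]
    have key := log_Gamma_convex_comb hy (add_pos hx hy) (inv_nonneg.2 hx.le)
      (inv_le_one_of_one_le₀ h)
    rw [show x⁻¹ * y + (1 - x⁻¹) * (x + y) = y + (x - 1) by field_simp; ring] at key
    have h1 := log_Gamma_add_one_s14 (show 0 < y + (x - 1) by linarith)
    rw [show y + (x - 1) + 1 = x + y by ring] at h1
    have key := mul_le_mul_of_nonneg_left key hx.le
    field_simp at key
    nlinarith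

/-- Lower bound for a ratio of Gamma values. -/
theorem le_Gamma_add {x y : ℝ} (hx : 0 < x) (hy : 0 < y) (hxy : 1 < x + y) :
    (y + min (x - 1) 0) ^ x * Real.Gamma y ≤ Real.Gamma (x + y) := by
  have hc : 0 < y + min (x - 1) 0 := by
    rcases min_choice (x - 1) 0 with h | h <;> rw [h] <;> linarith
  have hG := Real.Gamma_pos_of_pos hy
  rw [← Real.log_le_log_iff (by positivity) (Real.Gamma_pos_of_pos (add_pos hx hy)),
    log_rpow_mul_Gamma hc hy]
  rcases le_total x 1 with h | h
  · rw [min_eq_left (by linarith)] at hc ⊢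
    have key := log_Gamma_convex_comb hc (add_pos hx hy) hx.le h
    rw [show x * (y + (x - 1)) + (1 - x) * (x + y) = y by ring] at key
    have h1 := log_Gamma_add_one_s14 hc
    rw [show y + (x - 1) + 1 = x + y by ring] at h1
    rw [h1] at key ⊢
    linarith
  · rw [min_eq_right (by linarith), add_zero]
    have key := log_Gamma_convex_comb (add_pos hx hy) hy (inv_nonneg.2 hx.le)
      (inv_le_one_of_one_le₀ h)
    rw [show x⁻¹ * (x + y) + (1 - x⁻¹) * y = y + 1 by field_simp; ring,
      log_Gamma_add_one_s14 hy] at key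
    have key := mul_le_mul_of_nonneg_left key hx.le
    field_simp at key
    nlinarith

theorem mul_Gamma_le_max {x : ℝ} (hx : 0 < x) : x * Real.Gamma x ≤ max 1 (x ^ x) := by
  have h := Gamma_add_le hx one_pos
  rw [Real.Gamma_add_one hx.ne', Real.Gamma_one, mul_one] at h
  refine h.trans ?_
  rcases le_total x 1 with h | h
  · rw [max_eq_right (a := x - 1) (by linarith)]
    simp
  · rw [max_eq_left (a := x - 1) (by linarith), add_sub_cancel]
    exact le_max_right _ _

theorem betaFn_eq_Gamma {x y : ℝ} (hx : 0 < x) (hy : 0 < y) :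
    betaFn x y = Real.Gamma x * Real.Gamma y / Real.Gamma (x + y) := by
  have h : Complex.betaIntegral x y = (betaFn x y : ℂ) := by
    rw [Complex.betaIntegral, betaFn, ← intervalIntegral.integral_ofReal]
    refine intervalIntegral.integral_congr fun t ht => ?_
    rw [Set.uIcc_of_le zero_le_one] at ht
    simp only [Complex.ofReal_mul]
    rw [Complex.ofReal_cpow ht.1, Complex.ofReal_cpow (sub_nonneg.2 ht.2)]
    push_cast
    rfl
  have hG := Complex.Gamma_mul_Gamma_eq_betaIntegral (s := x) (t := y) (by simpa) (by simpa)
  rw [h, ← Complex.ofReal_add] at hG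
  simp only [Complex.Gamma_ofReal] at hG
  norm_cast at hG
  rw [hG, mul_div_cancel_left₀ _ (Real.Gamma_pos_of_pos (add_pos hx hy)).ne']

theorem stmt14 (x y : ℝ) (hx : 0 < x) (hy : 0 < y) (hxy : 1 < x + y) :
    Real.Gamma x / (y + max (x - 1) 0) ^ x ≤ betaFn x y
    ∧ betaFn x y ≤ Real.Gamma x / (y + min (x - 1) 0) ^ x
    ∧ Real.Gamma x / (y + min (x - 1) 0) ^ x
        ≤ max 1 (x ^ x) / (x * (y + min (x - 1) 0) ^ x) := by
  have hc : 0 < y + min (x - 1) 0 := by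
    rcases min_choice (x - 1) 0 with h | h <;> rw [h] <;> linarith
  have hc' : 0 < y + max (x - 1) 0 := by positivity
  have hGx := Real.Gamma_pos_of_pos hx
  have hGxy := Real.Gamma_pos_of_pos (add_pos hx hy)
  rw [betaFn_eq_Gamma hx hy]
  refine ⟨?_, ?_, ?_⟩
  · rw [div_le_div_iff₀ (by positivity) hGxy, mul_assoc, mul_comm (Real.Gamma y)]
    exact mul_le_mul_of_nonneg_left (Gamma_add_le hx hy) hGx.le
  · rw [div_le_div_iff₀ hGxy (by positivity), mul_assoc, mul_comm (Real.Gamma y)]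
    exact mul_le_mul_of_nonneg_left (le_Gamma_add hx hy hxy) hGx.le
  · rw [← mul_div_mul_left (Real.Gamma x) _ hx.ne']
    exact div_le_div_of_nonneg_right (mul_Gamma_le_max hx) (by positivity)
end

section
/- Let d, 𝐝, 𝐋, M ∈ ℕ, B, b ∈ [1,∞), u ∈ ℝ, v ∈ (u,∞), 𝐥 = (𝐥₀,…,𝐥_𝐋) ∈ ℕ^{𝐋+1} with 𝐥₀ = d, 𝐥_𝐋 = 1, 𝐝 ≥ Σ_{i=1}^{𝐋} 𝐥ᵢ(𝐥_{i−1}+1), D ⊆ [−b,b]^d, let Ω be a set, let X_j : Ω → D and Y_j : Ω → [u,v], j ∈ {1,…,M}, be functions, and let 𝓡 : [−B,B]^𝐝 × Ω → [0,∞) be given by 𝓡(θ,ω) = (1/M)Σ_{j=1}^M |N^{θ,𝐥}_{u,v}(X_j(ω)) − Y_j(ω)|². Then for all θ, ϑ ∈ [−B,B]^𝐝 and ω ∈ Ω: |𝓡(θ,ω) − 𝓡(ϑ,ω)| ≤ 2(v−u)·b·𝐋·(‖𝐥‖_∞+1)^𝐋·B^{𝐋−1}·‖θ−ϑ‖_∞.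 -/
/-- Realization of the rectified clipped DNN with parameter `θ`, layer dimensions `l`,
`L` affine transformations, scalar output (`l L = 1`), and clipping to `[u,v]`. -/
noncomputable def dnn (θ : ℕ → ℝ) (l : ℕ → ℕ) (L : ℕ) (u v : ℝ) (x : ℕ → ℝ) : ℝ :=
  max u (min (affine θ (off l (L - 1)) (l L) (l (L - 1)) (hiddenLayers θ l (L - 1) x) 0) v)

theorem abs_affine_le {θ x : ℕ → ℝ} {B K : ℝ} (hθ : ∀ i, |θ i| ≤ B) (hx : ∀ i, |x i| ≤ K)
    (s m n i : ℕ) : |affine θ s m n x i| ≤ B * (n * K + 1) := by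
  have hsum : |∑ j ∈ Finset.range n, θ (s + i * n + j) * x j| ≤ n * (B * K) := by
    refine (Finset.abs_sum_le_sum_abs _ _).trans ?_
    refine (Finset.sum_le_card_nsmul _ _ (B * K) fun j _ => ?_).trans
      (by rw [Finset.card_range, nsmul_eq_mul])
    rw [abs_mul]
    exact mul_le_mul (hθ _) (hx _) (abs_nonneg _) ((abs_nonneg _).trans (hθ 0))
  calc |affine θ s m n x i| ≤ n * (B * K) + B :=
        (abs_add_le _ _).trans (add_le_add hsum (hθ _))
    _ = B * (n * K + 1) := by ring

theorem abs_affine_sub_le {θ ϑ x y : ℕ → ℝ} {B K δ ε : ℝ} (hθ : ∀ i, |θ i| ≤ B)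
    (hy : ∀ i, |y i| ≤ K) (hδ : ∀ i, |θ i - ϑ i| ≤ δ) (hε : ∀ i, |x i - y i| ≤ ε)
    (s m n i : ℕ) :
    |affine θ s m n x i - affine ϑ s m n y i| ≤ n * (B * ε + δ * K) + δ := by
  have hsum : |∑ j ∈ Finset.range n,
      (θ (s + i * n + j) * (x j - y j) + (θ (s + i * n + j) - ϑ (s + i * n + j)) * y j)|
      ≤ n * (B * ε + δ * K) := by
    refine (Finset.abs_sum_le_sum_abs _ _).trans ?_
    refine (Finset.sum_le_card_nsmul _ _ (B * ε + δ * K) fun j _ => ?_).trans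
      (by rw [Finset.card_range, nsmul_eq_mul])
    refine (abs_add_le _ _).trans ?_
    rw [abs_mul, abs_mul]
    exact add_le_add
      (mul_le_mul (hθ _) (hε _) (abs_nonneg _) ((abs_nonneg _).trans (hθ 0)))
      (mul_le_mul (hδ _) (hy _) (abs_nonneg _) ((abs_nonneg _).trans (hδ 0)))
  have heq : affine θ s m n x i - affine ϑ s m n y i =
      (∑ j ∈ Finset.range n,
        (θ (s + i * n + j) * (x j - y j) + (θ (s + i * n + j) - ϑ (s + i * n + j)) * y j))
      + (θ (s + m * n + i) - ϑ (s + m * n + i)) := by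
    have : ∑ j ∈ Finset.range n,
        (θ (s + i * n + j) * (x j - y j) + (θ (s + i * n + j) - ϑ (s + i * n + j)) * y j) =
        ∑ j ∈ Finset.range n, θ (s + i * n + j) * x j
          - ∑ j ∈ Finset.range n, ϑ (s + i * n + j) * y j := by
      rw [← Finset.sum_sub_distrib]
      exact Finset.sum_congr rfl fun j _ => by ring
    rw [this]
    simp only [affine]
    ring
  rw [heq]
  exact (abs_add_le _ _).trans (add_le_add hsum (hδ _))

theorem abs_hiddenLayers_le {θ x : ℕ → ℝ} {l : ℕ → ℕ} {B b W : ℝ} (hB : 1 ≤ B) (hb : 1 ≤ b)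
    (hW : 0 ≤ W) (hθ : ∀ i, |θ i| ≤ B) (hx : ∀ i, |x i| ≤ b) (k : ℕ)
    (hl : ∀ i < k, (l i : ℝ) ≤ W) (i : ℕ) :
    |hiddenLayers θ l k x i| ≤ (W + 1) ^ k * B ^ k * b := by
  induction k generalizing i with
  | zero => simpa [hiddenLayers] using hx i
  | succ k ih =>
    have ih := ih fun i hi => hl i (hi.trans k.lt_succ_self)
    set K := (W + 1) ^ k * B ^ k * b with hK
    have hK1 : 1 ≤ K :=
      one_le_mul_of_one_le_of_one_le
        (one_le_mul_of_one_le_of_one_le (one_le_pow₀ (by linarith)) (one_le_pow₀ hB)) hb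
    have hrelu : ∀ a : ℝ, |max a 0| ≤ |a| := fun a => by
      rw [abs_of_nonneg (le_max_right a 0)]
      exact max_le (le_abs_self a) (abs_nonneg a)
    calc |hiddenLayers θ l (k + 1) x i|
        ≤ B * (l k * K + 1) := (hrelu _).trans (abs_affine_le hθ ih _ _ _ _)
      _ ≤ B * (W * K + K) := by
          have := hl k k.lt_succ_self
          gcongr
      _ = (W + 1) ^ (k + 1) * B ^ (k + 1) * b := by rw [hK]; ring

/-- One layer of the parameter-perturbation recursion, for the scaled error bound `B * ε`. -/
theorem affine_error_le {θ ϑ x y : ℕ → ℝ} {B b W δ ε : ℝ} {n k : ℕ} (hB : 1 ≤ B) (hb : 1 ≤ b)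
    (hn : (n : ℝ) ≤ W) (hθ : ∀ i, |θ i| ≤ B) (hδ : ∀ i, |θ i - ϑ i| ≤ δ)
    (hy : ∀ i, |y i| ≤ (W + 1) ^ k * B ^ k * b) (hε : ∀ i, |x i - y i| ≤ ε)
    (hBε : B * ε ≤ k * (W + 1) ^ k * B ^ k * b * δ) (s m i : ℕ) :
    |affine θ s m n x i - affine ϑ s m n y i| ≤ (k + 1) * (W + 1) ^ (k + 1) * B ^ k * b * δ := by
  have hW : 0 ≤ W := n.cast_nonneg.trans hn
  have hδ0 : 0 ≤ δ := (abs_nonneg _).trans (hδ 0)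
  have hε0 : 0 ≤ ε := (abs_nonneg _).trans (hε 0)
  set K := (W + 1) ^ k * B ^ k * b with hK
  have hK1 : 1 ≤ K :=
    one_le_mul_of_one_le_of_one_le
      (one_le_mul_of_one_le_of_one_le (one_le_pow₀ (by linarith)) (one_le_pow₀ hB)) hb
  calc |affine θ s m n x i - affine ϑ s m n y i|
      ≤ n * (B * ε + δ * K) + δ := abs_affine_sub_le hθ hy hδ hε _ _ _ _
    _ ≤ W * (B * ε + δ * K) + δ * K := by
        gcongr
        exact le_mul_of_one_le_right hδ0 hK1
    _ ≤ W * (k * (W + 1) ^ k * B ^ k * b * δ + δ * K) + δ * K := by gcongr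
    _ ≤ (W + 1) * (k * (W + 1) ^ k * B ^ k * b * δ + δ * K) := by
        have : 0 ≤ k * (W + 1) ^ k * B ^ k * b * δ := by positivity
        linarith
    _ = (k + 1) * (W + 1) ^ (k + 1) * B ^ k * b * δ := by rw [hK]; ring

theorem abs_hiddenLayers_sub_le {θ ϑ x : ℕ → ℝ} {l : ℕ → ℕ} {B b W δ : ℝ} (hB : 1 ≤ B)
    (hb : 1 ≤ b) (hW : 0 ≤ W) (hθ : ∀ i, |θ i| ≤ B) (hϑ : ∀ i, |ϑ i| ≤ B)
    (hδ : ∀ i, |θ i - ϑ i| ≤ δ) (hx : ∀ i, |x i| ≤ b) (k : ℕ)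
    (hl : ∀ i < k, (l i : ℝ) ≤ W) (i : ℕ) :
    |hiddenLayers θ l k x i - hiddenLayers ϑ l k x i|
      ≤ k * (W + 1) ^ k * B ^ k * b * δ / B := by
  have hB0 : 0 < B := by linarith
  induction k generalizing i with
  | zero => simp [hiddenLayers]
  | succ k ih =>
    have hl' : ∀ i < k, (l i : ℝ) ≤ W := fun i hi => hl i (hi.trans k.lt_succ_self)
    refine (abs_max_sub_max_le_abs _ _ _).trans ?_
    refine (affine_error_le hB hb (hl k k.lt_succ_self) hθ hδ
      (abs_hiddenLayers_le hB hb hW hϑ hx k hl') (ih hl')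
      (mul_div_cancel₀ _ hB0.ne').le _ _ _).trans (le_of_eq ?_)
    push_cast
    field_simp
    ring

theorem abs_dnn_sub_le {θ ϑ x : ℕ → ℝ} {l : ℕ → ℕ} {L : ℕ} {B b W δ : ℝ} (u v : ℝ)
    (hL : 0 < L) (hB : 1 ≤ B) (hb : 1 ≤ b) (hθ : ∀ i, |θ i| ≤ B)
    (hϑ : ∀ i, |ϑ i| ≤ B) (hδ : ∀ i, |θ i - ϑ i| ≤ δ) (hx : ∀ i, |x i| ≤ b)
    (hl : ∀ i < L, (l i : ℝ) ≤ W) :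
    |dnn θ l L u v x - dnn ϑ l L u v x| ≤ L * (W + 1) ^ L * B ^ (L - 1) * b * δ := by
  have hW : 0 ≤ W := (l 0).cast_nonneg.trans (hl 0 hL)
  obtain ⟨k, rfl⟩ : ∃ k, L = k + 1 := ⟨L - 1, by omega⟩
  have hl' : ∀ i < k, (l i : ℝ) ≤ W := fun i hi => hl i (hi.trans k.lt_succ_self)
  have hclip : ∀ a c : ℝ, |max u (min a v) - max u (min c v)| ≤ |a - c| := fun a c => by
    rw [max_comm u, max_comm u]
    refine (abs_max_sub_max_le_abs _ _ _).trans ?_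
    simpa using abs_min_sub_min_le_max a v c v
  refine (hclip _ _).trans ?_
  simp only [Nat.add_sub_cancel]
  push_cast
  exact affine_error_le hB hb (hl k k.lt_succ_self) hθ hδ
    (abs_hiddenLayers_le hB hb hW hϑ hx k hl')
    (abs_hiddenLayers_sub_le hB hb hW hθ hϑ hδ hx k hl')
    (mul_div_cancel₀ _ (by linarith : B ≠ 0)).le _ _ _

theorem dnn_mem_Icc {u v : ℝ} (huv : u ≤ v) (θ : ℕ → ℝ) (l : ℕ → ℕ) (L : ℕ) (x : ℕ → ℝ) :
    dnn θ l L u v x ∈ Set.Icc u v :=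
  ⟨le_max_left _ _, max_le huv (min_le_right _ _)⟩

theorem abs_sq_sub_sq_le {u v p q y : ℝ} (hp : p ∈ Set.Icc u v) (hq : q ∈ Set.Icc u v)
    (hy : y ∈ Set.Icc u v) : |(|p - y| ^ 2 - |q - y| ^ 2)| ≤ 2 * (v - u) * |p - q| := by
  rw [sq_abs, sq_abs, show (p - y) ^ 2 - (q - y) ^ 2 = (p + q - 2 * y) * (p - q) by ring, abs_mul]
  refine mul_le_mul_of_nonneg_right (abs_le.2 ⟨?_, ?_⟩) (abs_nonneg _) <;>
    linarith [hp.1, hp.2, hq.1, hq.2, hy.1, hy.2]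

theorem abs_pad_le {m : ℕ} {θ : Fin m → ℝ} {B : ℝ} (hB : 0 ≤ B)
    (hθ : ∀ i, θ i ∈ Set.Icc (-B) B) (i : ℕ) : |pad θ i| ≤ B := by
  unfold pad
  split_ifs with h
  · exact abs_le.2 (hθ ⟨i, h⟩)
  · simpa using hB

theorem abs_pad_sub_pad_le {m : ℕ} (θ ϑ : Fin m → ℝ) (i : ℕ) :
    |pad θ i - pad ϑ i| ≤ ⨆ i, |θ i - ϑ i| := by
  unfold pad
  split_ifs with h
  · exact le_ciSup (f := fun i => |θ i - ϑ i|) (Set.finite_range _).bddAbove ⟨i, h⟩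
  · simpa using Real.iSup_nonneg fun i => abs_nonneg (θ i - ϑ i)


theorem stmt17 (d dd LL M : ℕ) (hd : 0 < d) (hdd : 0 < dd) (hLL : 0 < LL) (hM : 0 < M)
    (B b : ℝ) (hB : 1 ≤ B) (hb : 1 ≤ b) (u v : ℝ) (huv : u < v)
    (l : ℕ → ℕ) (hl : ∀ i, i ≤ LL → 0 < l i) (hl0 : l 0 = d) (hlL : l LL = 1)
    (hdim : ∑ i ∈ Finset.range LL, l (i + 1) * (l i + 1) ≤ dd)
    (D : Set (Fin d → ℝ)) (hD : ∀ x ∈ D, ∀ i, x i ∈ Set.Icc (-b) b)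
    {Ω : Type*} (X : Fin M → Ω → (Fin d → ℝ)) (Y : Fin M → Ω → ℝ)
    (hX : ∀ j ω, X j ω ∈ D) (hY : ∀ j ω, Y j ω ∈ Set.Icc u v)
    (θ ϑ : Fin dd → ℝ) (hθ : ∀ i, θ i ∈ Set.Icc (-B) B) (hϑ : ∀ i, ϑ i ∈ Set.Icc (-B) B)
    (ω : Ω) :
    |(M : ℝ)⁻¹ * (∑ j, |dnn (pad θ) l LL u v (pad (X j ω)) - Y j ω| ^ 2)
      - (M : ℝ)⁻¹ * (∑ j, |dnn (pad ϑ) l LL u v (pad (X j ω)) - Y j ω| ^ 2)|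
      ≤ 2 * (v - u) * b * LL * ((((Finset.range (LL + 1)).sup l : ℕ) : ℝ) + 1) ^ LL *
          B ^ (LL - 1) * ⨆ i, |θ i - ϑ i| := by
  set W : ℝ := (((Finset.range (LL + 1)).sup l : ℕ) : ℝ) with hW
  set δ : ℝ := ⨆ i, |θ i - ϑ i| with hδ
  have hlW : ∀ i < LL, (l i : ℝ) ≤ W := fun i hi => by
    rw [hW]
    exact_mod_cast Finset.le_sup (f := l) (Finset.mem_range.2 (hi.trans LL.lt_succ_self))
  have hterm : ∀ j, |(|dnn (pad θ) l LL u v (pad (X j ω)) - Y j ω| ^ 2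
      - |dnn (pad ϑ) l LL u v (pad (X j ω)) - Y j ω| ^ 2)|
      ≤ 2 * (v - u) * (LL * (W + 1) ^ LL * B ^ (LL - 1) * b * δ) := fun j => by
    refine (abs_sq_sub_sq_le (dnn_mem_Icc huv.le _ _ _ _) (dnn_mem_Icc huv.le _ _ _ _)
      (hY j ω)).trans ?_
    refine mul_le_mul_of_nonneg_left ?_ (by linarith)
    exact abs_dnn_sub_le u v hLL hB hb (abs_pad_le (by linarith) hθ)
      (abs_pad_le (by linarith) hϑ) (abs_pad_sub_pad_le θ ϑ)
      (abs_pad_le (by linarith) (hD _ (hX j ω))) hlW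
  have hM0 : (0 : ℝ) < M := Nat.cast_pos.2 hM
  rw [← mul_sub, ← Finset.sum_sub_distrib, abs_mul, abs_of_pos (inv_pos.2 hM0),
    inv_mul_le_iff₀ hM0]
  refine (Finset.abs_sum_le_sum_abs _ _).trans ?_
  refine (Finset.sum_le_card_nsmul _ _ _ fun j _ => hterm j).trans (le_of_eq ?_)
  rw [Finset.card_univ, Fintype.card_fin, nsmul_eq_mul]
  ring
end
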